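/- arXiv:1306.0748 — 6 statements merged into one kernel-verified Lean document; each statement's English description precedes it below -/
import Mathlib

section
/- Let u: 𝕋^N×[0,∞) → ℝ be continuous with |u| ≤ C₀ and v: 𝕋^N → ℝ with |v| ≤ C₀, and let η > 0. Define P_{ημ}[u](x,t) := sup_{s≥t}{u(x,t)−v(x)−μ(u(x,s)−v(x))−μη(s−t)}. Then for every μ ≥ 1, x ∈ 𝕋^N and t ≥ 0: P_{ημ}[u](x,t) ≥ P_{η1}[u](x,t) − 4C₀(μ−1). In particular, for every ε>0 there exists μ_ε>1 such that P_{ημ}[u](x,t) ≥ P_{η1}[u](x,t) − ε for all 1 ≤ μ ≤ μ_ε, x, t; and if M_{η1}[u](t) := sup_x P_{η1}[u](x,t) satisfies M_{η1}[u](t) ≥ m₁ > 0 for all t ≥ 0, then M_{ημ}[u](t) := sup_x P_{ημ}[u](x,t) ≥ m₁/2 for all t ≥ 0 whenever 1 < μ ≤ 1 + m₁/(8C₀). -/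
open Filter
open scoped RealInnerProductSpace Matrix

noncomputable section

namespace LargeTimeBehavior

/-- Euclidean space ℝ^N; ℤ^N-periodic functions on it represent functions on the torus 𝕋^N. -/
abbrev E (N : ℕ) := EuclideanSpace ℝ (Fin N)

variable {N : ℕ} {Θ : Type*}

/-- `f` is ℤ^N-periodic. -/
def ZPeriodic {α : Type*} (f : E N → α) : Prop :=
  ∀ (x : E N) (k : Fin N → ℤ), f (x + (WithLp.equiv 2 (Fin N → ℝ)).symm fun i => (k i : ℝ)) = f x

/-- Hessian matrix of a real function on ℝ^N. -/
def hessMatrix (φ : E N → ℝ) (x : E N) : Matrix (Fin N) (Fin N) ℝ :=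
  Matrix.of fun i j =>
    fderiv ℝ (fun y => fderiv ℝ φ y (EuclideanSpace.single j 1)) x (EuclideanSpace.single i 1)

/-- The totally degenerate set Σ = {x : A_θ(x) = 0 for all θ}. -/
def degenSet (A : Θ → E N → Matrix (Fin N) (Fin N) ℝ) : Set (E N) :=
  {x | ∀ θ, A θ x = 0}

/-- Value of the operator −trace(A_θ(x)D²φ) + H_θ(x,Dφ) on a C² test function φ at x. -/
def opVal (A : Θ → E N → Matrix (Fin N) (Fin N) ℝ) (H : Θ → E N → E N → ℝ)
    (θ : Θ) (x : E N) (φ : E N → ℝ) : ℝ :=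
  -Matrix.trace (A θ x * hessMatrix φ x) + H θ x (gradient φ x)

/-- Viscosity subsolution of ∂u/∂t + sup_θ{−tr(A_θD²u)+H_θ(x,Du)} = 0 on ℝ^N×(0,∞). -/
def IsSubSolCP (A : Θ → E N → Matrix (Fin N) (Fin N) ℝ) (H : Θ → E N → E N → ℝ)
    (u : E N → ℝ → ℝ) : Prop :=
  ∀ φ : E N → ℝ → ℝ, ContDiff ℝ 2 (fun q : E N × ℝ => φ q.1 q.2) →
    ∀ (x₀ : E N) (t₀ : ℝ), 0 < t₀ →
      IsLocalMax (fun q : E N × ℝ => u q.1 q.2 - φ q.1 q.2) (x₀, t₀) →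
      deriv (φ x₀) t₀ + (⨆ θ, opVal A H θ x₀ fun y => φ y t₀) ≤ 0

/-- Viscosity supersolution of the Cauchy problem. -/
def IsSuperSolCP (A : Θ → E N → Matrix (Fin N) (Fin N) ℝ) (H : Θ → E N → E N → ℝ)
    (u : E N → ℝ → ℝ) : Prop :=
  ∀ φ : E N → ℝ → ℝ, ContDiff ℝ 2 (fun q : E N × ℝ => φ q.1 q.2) →
    ∀ (x₀ : E N) (t₀ : ℝ), 0 < t₀ →
      IsLocalMin (fun q : E N × ℝ => u q.1 q.2 - φ q.1 q.2) (x₀, t₀) →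
      0 ≤ deriv (φ x₀) t₀ + (⨆ θ, opVal A H θ x₀ fun y => φ y t₀)

/-- Viscosity solution of the Cauchy problem. -/
def IsSolCP (A : Θ → E N → Matrix (Fin N) (Fin N) ℝ) (H : Θ → E N → E N → ℝ)
    (u : E N → ℝ → ℝ) : Prop :=
  IsSubSolCP A H u ∧ IsSuperSolCP A H u

/-- Viscosity subsolution of the ergodic problem sup_θ{−tr(A_θD²v)+H_θ(x,Dv)} = c. -/
def IsSubSolErg (A : Θ → E N → Matrix (Fin N) (Fin N) ℝ) (H : Θ → E N → E N → ℝ)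
    (c : ℝ) (v : E N → ℝ) : Prop :=
  ∀ φ : E N → ℝ, ContDiff ℝ 2 φ → ∀ x₀ : E N,
    IsLocalMax (fun x => v x - φ x) x₀ → (⨆ θ, opVal A H θ x₀ φ) ≤ c

/-- Viscosity supersolution of the ergodic problem. -/
def IsSuperSolErg (A : Θ → E N → Matrix (Fin N) (Fin N) ℝ) (H : Θ → E N → E N → ℝ)
    (c : ℝ) (v : E N → ℝ) : Prop :=
  ∀ φ : E N → ℝ, ContDiff ℝ 2 φ → ∀ x₀ : E N,
    IsLocalMin (fun x => v x - φ x) x₀ → c ≤ (⨆ θ, opVal A H θ x₀ φ)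

/-- Viscosity solution of the ergodic problem. -/
def IsSolErg (A : Θ → E N → Matrix (Fin N) (Fin N) ℝ) (H : Θ → E N → E N → ℝ)
    (c : ℝ) (v : E N → ℝ) : Prop :=
  IsSubSolErg A H c v ∧ IsSuperSolErg A H c v

/-- Viscosity subsolution of the discounted equation λw + sup_θ{−tr(A_θD²w)+H_θ(x,Dw)} = 0. -/
def IsSubSolDisc (A : Θ → E N → Matrix (Fin N) (Fin N) ℝ) (H : Θ → E N → E N → ℝ)
    (lam : ℝ) (w : E N → ℝ) : Prop :=
  ∀ φ : E N → ℝ, ContDiff ℝ 2 φ → ∀ x₀ : E N,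
    IsLocalMax (fun x => w x - φ x) x₀ → lam * w x₀ + (⨆ θ, opVal A H θ x₀ φ) ≤ 0

/-- Viscosity supersolution of the discounted equation. -/
def IsSuperSolDisc (A : Θ → E N → Matrix (Fin N) (Fin N) ℝ) (H : Θ → E N → E N → ℝ)
    (lam : ℝ) (w : E N → ℝ) : Prop :=
  ∀ φ : E N → ℝ, ContDiff ℝ 2 φ → ∀ x₀ : E N,
    IsLocalMin (fun x => w x - φ x) x₀ → 0 ≤ lam * w x₀ + (⨆ θ, opVal A H θ x₀ φ)

/-- Viscosity solution of the discounted equation. -/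
def IsSolDisc (A : Θ → E N → Matrix (Fin N) (Fin N) ℝ) (H : Θ → E N → E N → ℝ)
    (lam : ℝ) (w : E N → ℝ) : Prop :=
  IsSubSolDisc A H lam w ∧ IsSuperSolDisc A H lam w

/-- P_{ημ}[u](x,t) = sup_{s ≥ t} { u(x,t) − v(x) − μ(u(x,s) − v(x)) − μη(s−t) }. -/
def Pfun (u : E N → ℝ → ℝ) (v : E N → ℝ) (η μ : ℝ) (x : E N) (t : ℝ) : ℝ :=
  sSup ((fun s => u x t - v x - μ * (u x s - v x) - μ * η * (s - t)) '' Set.Ici t)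

/-- M_{ημ}[u](t) = sup_x P_{ημ}[u](x,t). -/
def Mfun (u : E N → ℝ → ℝ) (v : E N → ℝ) (η μ : ℝ) (t : ℝ) : ℝ :=
  sSup (Set.range fun x : E N => Pfun u v η μ x t)

/-- Viscosity subsolution of
  min{ U , ∂U/∂t + inf_θ{−tr(A_θ(x)D²U)} − C₀|DU| } ≤ 0 on ℝ^N×(0,∞). -/
def IsSubSolMinIneq (A : Θ → E N → Matrix (Fin N) (Fin N) ℝ) (C₀ : ℝ)
    (U : E N → ℝ → ℝ) : Prop :=
  ∀ φ : E N → ℝ → ℝ, ContDiff ℝ 2 (fun q : E N × ℝ => φ q.1 q.2) →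
    ∀ (x₀ : E N) (t₀ : ℝ), 0 < t₀ →
      IsLocalMax (fun q : E N × ℝ => U q.1 q.2 - φ q.1 q.2) (x₀, t₀) →
      U x₀ t₀ ≤ 0 ∨
        deriv (φ x₀) t₀ + (⨅ θ, -Matrix.trace (A θ x₀ * hessMatrix (fun y => φ y t₀) x₀))
          - C₀ * ‖gradient (fun y => φ y t₀) x₀‖ ≤ 0

/-- The unit cube [0,1]^N. -/
def cube (N : ℕ) : Set (E N) := {x | ∀ i, x i ∈ Set.Icc (0:ℝ) 1}

/-- Assumption (sur-sol-stricte) with constant C. -/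
def SurSolStricte (A : Θ → E N → Matrix (Fin N) (Fin N) ℝ) (C : ℝ) : Prop :=
  ∀ δ > (0:ℝ), ∃ ψ : E N → ℝ, ContDiff ℝ 2 ψ ∧
    ∃ Ω : Set (E N), IsOpen Ω ∧ Bornology.IsBounded Ω ∧ cube N ⊆ Ω ∧
      (∀ x ∈ Ω, ψ x ≤ 0) ∧ (∀ x ∉ Ω, 0 ≤ ψ x) ∧
      ∀ x ∈ Ω, (∀ y ∈ degenSet A, δ < dist x y) →
        0 < (⨅ θ, -Matrix.trace (A θ x * hessMatrix ψ x)) - C * ‖gradient ψ x‖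

/-- Assumption (inver_dege): uniform ellipticity at distance > δ from Σ. -/
def InverDege (A : Θ → E N → Matrix (Fin N) (Fin N) ℝ) : Prop :=
  ∀ δ > (0:ℝ), ∃ ν > (0:ℝ), ∀ (θ : Θ) (x : E N),
    (∀ y ∈ degenSet A, δ < dist x y) →
    (A θ x - ν • (1 : Matrix (Fin N) (Fin N) ℝ)).PosSemidef

/-- Frobenius norm of a matrix. -/
def mnorm (M : Matrix (Fin N) (Fin N) ℝ) : ℝ := Real.sqrt (∑ i, ∑ j, (M i j)^2)

theorem Pfun_aux_le {N : ℕ} (C₀ : ℝ) (u : E N → ℝ → ℝ)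
    (hubd : ∀ (x : E N) (t : ℝ), |u x t| ≤ C₀)
    (v : E N → ℝ) (hvbd : ∀ x : E N, |v x| ≤ C₀)
    (η : ℝ) (hη : 0 < η) (μ : ℝ) (hμ : 1 ≤ μ) (x : E N) (t s : ℝ) (hs : t ≤ s) :
    u x t - v x - μ * (u x s - v x) - μ * η * (s - t) ≤ 2 * C₀ + 2 * C₀ * μ := by
  have h1 := abs_le.1 (hubd x t)
  have h2 := abs_le.1 (hubd x s)
  have h3 := abs_le.1 (hvbd x)
  have h4 : 0 ≤ μ * η * (s - t) := by
    have : 0 ≤ s - t := by linarith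
    positivity
  have h5 : 0 ≤ μ * (u x s - v x + 2 * C₀) := mul_nonneg (by linarith) (by linarith)
  nlinarith

theorem Pfun_aux_bdd {N : ℕ} (C₀ : ℝ) (u : E N → ℝ → ℝ)
    (hubd : ∀ (x : E N) (t : ℝ), |u x t| ≤ C₀)
    (v : E N → ℝ) (hvbd : ∀ x : E N, |v x| ≤ C₀)
    (η : ℝ) (hη : 0 < η) (μ : ℝ) (hμ : 1 ≤ μ) (x : E N) (t : ℝ) :
    BddAbove ((fun s => u x t - v x - μ * (u x s - v x) - μ * η * (s - t)) '' Set.Ici t) := by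
  refine ⟨2 * C₀ + 2 * C₀ * μ, ?_⟩
  rintro _ ⟨s, hs, rfl⟩
  exact Pfun_aux_le C₀ u hubd v hvbd η hη μ hμ x t s hs

theorem Pfun_aux_main {N : ℕ} (C₀ : ℝ) (hC₀ : 0 < C₀) (u : E N → ℝ → ℝ)
    (hubd : ∀ (x : E N) (t : ℝ), |u x t| ≤ C₀)
    (v : E N → ℝ) (hvbd : ∀ x : E N, |v x| ≤ C₀)
    (η : ℝ) (hη : 0 < η) (μ : ℝ) (hμ : 1 ≤ μ) (x : E N) (t : ℝ) :
    Pfun u v η 1 x t - 4 * C₀ * (μ - 1) ≤ Pfun u v η μ x t := by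
  have hb := Pfun_aux_bdd C₀ u hubd v hvbd η hη μ hμ x t
  have key : Pfun u v η 1 x t ≤ Pfun u v η μ x t + 4 * C₀ * (μ - 1) := by
    refine csSup_le (Set.nonempty_Ici.image _) ?_
    rintro _ ⟨s, hs, rfl⟩
    have h1 := abs_le.1 (hubd x t)
    have h3 := abs_le.1 (hvbd x)
    have hm : 0 ≤ μ - 1 := by linarith
    have hPs : _ ≤ Pfun u v η μ x t := le_csSup hb ⟨s, hs, rfl⟩
    have hPt : _ ≤ Pfun u v η μ x t := le_csSup hb ⟨t, Set.self_mem_Ici, rfl⟩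
    dsimp only at hPs hPt ⊢
    by_cases h : 0 ≤ u x t - u x s - η * (s - t)
    · have := mul_nonneg hm (by linarith : 0 ≤ 4 * C₀ - (u x s - v x + η * (s - t)))
      nlinarith
    · have := mul_nonneg hm (by linarith : 0 ≤ 4 * C₀ - (u x t - v x))
      nlinarith
  linarith

theorem statement8
    {N : ℕ}
    (C₀ : ℝ) (hC₀ : 0 < C₀)
    (u : E N → ℝ → ℝ)
    (hucont : ContinuousOn (fun q : E N × ℝ => u q.1 q.2) (Set.univ ×ˢ Set.Ici 0))
    (huper : ∀ t : ℝ, ZPeriodic fun x => u x t)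
    (hubd : ∀ (x : E N) (t : ℝ), |u x t| ≤ C₀)
    (v : E N → ℝ) (hvper : ZPeriodic v) (hvbd : ∀ x : E N, |v x| ≤ C₀)
    (η : ℝ) (hη : 0 < η) :
    (∀ μ : ℝ, 1 ≤ μ → ∀ (x : E N) (t : ℝ), 0 ≤ t →
      Pfun u v η 1 x t - 4 * C₀ * (μ - 1) ≤ Pfun u v η μ x t) ∧
    (∀ ε > (0:ℝ), ∃ με > (1:ℝ), ∀ μ : ℝ, 1 ≤ μ → μ ≤ με → ∀ (x : E N) (t : ℝ), 0 ≤ t →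
      Pfun u v η 1 x t - ε ≤ Pfun u v η μ x t) ∧
    (∀ m₁ > (0:ℝ), (∀ t : ℝ, 0 ≤ t → m₁ ≤ Mfun u v η 1 t) →
      ∀ μ : ℝ, 1 < μ → μ ≤ 1 + m₁ / (8 * C₀) → ∀ t : ℝ, 0 ≤ t →
        m₁ / 2 ≤ Mfun u v η μ t) := by
  have A := Pfun_aux_main C₀ hC₀ u hubd v hvbd η hη
  refine ⟨fun μ hμ x t _ => A μ hμ x t, fun ε hε => ?_, fun m₁ hm₁ hM μ hμ hμ' t ht => ?_⟩
  · refine ⟨1 + ε / (4 * C₀), by have : 0 < ε / (4 * C₀) := by positivity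
                                 linarith, fun μ h1 h2 x t _ => ?_⟩
    have h := A μ h1 x t
    have h3 : (μ - 1) ≤ ε / (4 * C₀) := by linarith
    rw [le_div_iff₀ (by positivity)] at h3
    linarith
  · have h3 : (μ - 1) ≤ m₁ / (8 * C₀) := by linarith
    rw [le_div_iff₀ (by positivity)] at h3
    have hb : BddAbove (Set.range fun x : E N => Pfun u v η μ x t) := by
      refine ⟨2 * C₀ + 2 * C₀ * μ, ?_⟩
      rintro _ ⟨x, rfl⟩
      refine csSup_le (Set.nonempty_Ici.image _) ?_
      rintro _ ⟨s, hs, rfl⟩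
      exact Pfun_aux_le C₀ u hubd v hvbd η hη μ hμ.le x t s hs
    have key : Mfun u v η 1 t ≤ Mfun u v η μ t + 4 * C₀ * (μ - 1) := by
      refine csSup_le (Set.range_nonempty _) ?_
      rintro _ ⟨x, rfl⟩
      have h1 := A μ hμ.le x t
      have h2 : Pfun u v η μ x t ≤ Mfun u v η μ t := le_csSup hb ⟨x, rfl⟩
      dsimp only
      linarith
    have := hM t ht
    linarith

end LargeTimeBehavior
end
end

section
/- Under the steady assumptions (H1)–(H3) normalized so that the ergodic constant is c=0, with (inver_dege) (for every δ>0 there exists ν_δ>0 such that A_θ(x) ≥ ν_δ I for all θ∈Θ and all x with dist(x,Σ) > δ), let ũ be a bounded Lipschitz viscosity solution of the Cauchy problem (CP), v a bounded Lipschitz solution of the ergodic equation with c=0, η>0 and μ>1 such that: M_{ημ}[ũ](t) = m_{ημ} > 0 is independent of t, and P_{ημ}[ũ] is a viscosity subsolution of min{U, ∂U/∂t + inf_θ{−trace(A_θ(x)D²U)} − C₀|DU|} ≤ 0 on 𝕋^N×(0,∞). Then for any τ>0, if Σ ≠ ∅, the maximum max_{x∈𝕋^N, t≥0} P_{ημ}[ũ](x,t)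 = M_{ημ}[ũ](τ) = m_{ημ} is attained at a point (x_τ, τ) with x_τ ∈ Σ; and if Σ = ∅, then m_{η1} = 0 (so the assumption m_{η1} > 0 forces Σ ≠ ∅). -/
open Filter
open scoped RealInnerProductSpace Matrix

noncomputable section

namespace LargeTimeBehavior

variable {N : ℕ} {Θ : Type*}

lemma hasFDerivAt_bar (x₀ : E N) (m δ b k e₀ : ℝ) (y : E N) :
    HasFDerivAt (fun y : E N => m - δ * (Real.exp (-(b * ‖y - x₀‖^2 + k)) - e₀))
      ((δ * Real.exp (-(b * ‖y - x₀‖^2 + k)) * (2 * b)) • innerSL ℝ (y - x₀)) y := by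
  have h1 : HasFDerivAt (fun y : E N => ‖y - x₀‖^2) (2 • (innerSL ℝ (y - x₀))) y := by
    have := ((hasFDerivAt_id y).sub_const x₀).norm_sq
    simpa using this
  have h2 := ((((h1.const_mul b).add_const k).neg.exp).sub_const e₀).const_mul δ |>.const_sub m
  refine h2.congr_fderiv ?_
  ext v
  simp
  ring

lemma grad_bar (x₀ : E N) (m δ b k e₀ : ℝ) (y : E N) :
    gradient (fun y : E N => m - δ * (Real.exp (-(b * ‖y - x₀‖^2 + k)) - e₀)) y
      = (δ * Real.exp (-(b * ‖y - x₀‖^2 + k)) * (2 * b)) • (y - x₀) := by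
  apply HasGradientAt.gradient
  rw [hasGradientAt_iff_hasFDerivAt]
  refine (hasFDerivAt_bar x₀ m δ b k e₀ y).congr_fderiv ?_
  ext v
  simp

lemma hess_bar (x₀ : E N) (m δ b k e₀ : ℝ) (y : E N) :
    hessMatrix (fun y : E N => m - δ * (Real.exp (-(b * ‖y - x₀‖^2 + k)) - e₀)) y
      = (δ * Real.exp (-(b * ‖y - x₀‖^2 + k)) * (2 * b)) •
        ((1 : Matrix (Fin N) (Fin N) ℝ) - (2 * b) • Matrix.vecMulVec (y - x₀).ofLp (y - x₀).ofLp) := by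
  ext i j
  have e : (fun y' : E N => fderiv ℝ (fun y : E N => m - δ * (Real.exp (-(b * ‖y - x₀‖^2 + k)) - e₀)) y'
      (EuclideanSpace.single j 1)) =
      fun y' => (0 - (-(δ * (2 * b))) * (Real.exp (-(b * ‖y' - x₀‖^2 + k)) - 0)) * (y' - x₀) j := by
    funext y'
    rw [(hasFDerivAt_bar x₀ m δ b k e₀ y').fderiv]
    simp [EuclideanSpace.inner_single_right]
    left
    ring
  simp only [hessMatrix, Matrix.of_apply]
  rw [e]
  have h1 := hasFDerivAt_bar x₀ 0 (-(δ * (2 * b))) b k 0 y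
  have h2 : HasFDerivAt (fun y' : E N => (y' - x₀) j) (EuclideanSpace.proj j : E N →L[ℝ] ℝ) y := by
    have := ((EuclideanSpace.proj j : E N →L[ℝ] ℝ).hasFDerivAt (x := y)).sub_const (x₀ j)
    simpa using this
  refine (congrArg (fun L : E N →L[ℝ] ℝ => L (EuclideanSpace.single i 1)) (h1.mul h2).fderiv).trans ?_
  simp [EuclideanSpace.inner_single_right, Matrix.vecMulVec_apply, Matrix.one_apply, eq_comm]
  split_ifs <;> ring

lemma trace_quad (A : Matrix (Fin N) (Fin N) ℝ) (w : Fin N → ℝ) (a b : ℝ) :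
    Matrix.trace (A * (a • ((1 : Matrix (Fin N) (Fin N) ℝ) - b • Matrix.vecMulVec w w)))
      = a * (A.trace - b * (w ⬝ᵥ (A *ᵥ w))) := by
  rw [Matrix.mul_smul, Matrix.mul_sub, Matrix.mul_smul, Matrix.mul_vecMulVec]
  simp [Matrix.trace_vecMulVec, dotProduct_comm]

lemma quad_lower (A : Matrix (Fin N) (Fin N) ℝ) (ν : ℝ)
    (h : (A - ν • (1 : Matrix (Fin N) (Fin N) ℝ)).PosSemidef) (w : E N) :
    ν * ‖w‖^2 ≤ (w.ofLp ⬝ᵥ (A *ᵥ w.ofLp)) := by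
  have := h.dotProduct_mulVec_nonneg w.ofLp
  rw [EuclideanSpace.norm_sq_eq]
  simp [Matrix.sub_mulVec, Matrix.smul_mulVec, dotProduct_sub] at this
  simpa [dotProduct, sq] using this

lemma trace_upper (S : Matrix (Fin N) (Fin N) ℝ) (C : ℝ) (h : ∀ i j, |S i j| ≤ C) :
    (S * Sᵀ).trace ≤ N * (N * C^2) := by
  simp only [Matrix.trace, Matrix.diag, Matrix.mul_apply, Matrix.transpose_apply]
  calc _ ≤ ∑ i : Fin N, ∑ j : Fin N, C^2 := by
        refine Finset.sum_le_sum fun i _ => Finset.sum_le_sum fun j _ => ?_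
        rw [← sq, ← sq_abs]
        exact pow_le_pow_left₀ (abs_nonneg _) (h i j) 2
    _ = _ := by simp

/-- continuity and attainment -/
lemma P_props (u : E N → ℝ → ℝ) (v : E N → ℝ)
    (hu : ContinuousOn (fun q : E N × ℝ => u q.1 q.2) (Set.univ ×ˢ Set.Ici 0))
    (hv : Continuous v) (W : ℝ) (hW : ∀ x t, |u x t - v x| ≤ W) (η μ : ℝ) (hη : 0 < η) (hμ : 0 < μ) :
    (∃ Q : E N × ℝ → ℝ, Continuous Q ∧ ∀ x t, 0 ≤ t → Pfun u v η μ x t = Q (x, t)) ∧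
    (∀ x t, 0 ≤ t → ∃ s, t ≤ s ∧
      Pfun u v η μ x t = u x t - v x - μ * (u x s - v x) - μ * η * (s - t)) ∧
    (∀ x t s, t ≤ s →
      u x t - v x - μ * (u x s - v x) - μ * η * (s - t) ≤ Pfun u v η μ x t) := by
  have hW0 : 0 ≤ W := (abs_nonneg _).trans (hW 0 0)
  have hbd : ∀ x t, BddAbove ((fun s => u x t - v x - μ * (u x s - v x) - μ * η * (s - t)) '' Set.Ici t) := by
    intro x t
    refine ⟨W + μ * W, ?_⟩
    rintro _ ⟨s, hs, rfl⟩
    have h1 := abs_le.1 (hW x t)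
    have h2 := abs_le.1 (hW x s)
    have h3 : 0 ≤ μ * η * (s - t) := mul_nonneg (by positivity) (sub_nonneg.2 hs)
    have h4 : -(μ * W) ≤ μ * (u x s - v x) := by nlinarith
    simp only
    linarith
  have hle : ∀ x t s, t ≤ s →
      u x t - v x - μ * (u x s - v x) - μ * η * (s - t) ≤ Pfun u v η μ x t :=
    fun x t s hs => le_csSup (hbd x t) ⟨s, hs, rfl⟩
  set K := 2 * W / η with hK
  have hK0 : 0 ≤ K := by positivity
  have hKη : η * K = 2 * W := by rw [hK]; field_simp
  set f : E N × ℝ → ℝ → ℝ := fun q r => u q.1 (max q.2 0) - v q.1 - μ * (u q.1 (max q.2 0 + max r 0) - v q.1)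
    - μ * η * max r 0 with hf
  have hfc : Continuous (Function.uncurry f) := by
    have c1 : Continuous fun z : (E N × ℝ) × ℝ => u z.1.1 (max z.1.2 0) := by
      have := hu.comp_continuous (f := fun z : (E N × ℝ) × ℝ => (z.1.1, max z.1.2 0)) (by fun_prop)
        (by intro z; simp)
      exact this
    have c2 : Continuous fun z : (E N × ℝ) × ℝ => u z.1.1 (max z.1.2 0 + max z.2 0) := by
      have := hu.comp_continuous (f := fun z : (E N × ℝ) × ℝ => (z.1.1, max z.1.2 0 + max z.2 0)) (by fun_prop)
        (by intro z; simp; positivity)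
      exact this
    have c3 : Continuous fun z : (E N × ℝ) × ℝ => v z.1.1 := hv.comp (by fun_prop)
    have c4 : Continuous fun z : (E N × ℝ) × ℝ => max z.2 0 := by fun_prop
    exact ((c1.sub c3).sub (continuous_const.mul (c2.sub c3))).sub (continuous_const.mul c4)
  -- maximum over compact
  have key : ∀ x t, 0 ≤ t → ∃ r ∈ Set.Icc (0:ℝ) K, sSup (f (x,t) '' Set.Icc 0 K) = f (x,t) r ∧
      Pfun u v η μ x t = f (x,t) r := by
    intro x t ht
    have fc : Continuous (f (x,t)) := hfc.comp (by fun_prop : Continuous fun r : ℝ => ((x,t), r))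
    obtain ⟨r, hr, hr'⟩ := isCompact_Icc.exists_isMaxOn (Set.nonempty_Icc.2 hK0) fc.continuousOn
    have e : ∀ r, 0 ≤ r → f (x,t) r = u x t - v x - μ * (u x (t + r) - v x) - μ * η * (t + r - t) := by
      intro r hr
      simp [hf, max_eq_left ht, max_eq_left hr]
    refine ⟨r, hr, ?_, ?_⟩
    · apply IsGreatest.csSup_eq
      exact ⟨⟨r, hr, rfl⟩, by rintro _ ⟨r', h', rfl⟩; exact hr' h'⟩
    · apply IsGreatest.csSup_eq
      refine ⟨⟨t + r, by simpa using hr.1, by simp only; rw [e r hr.1]⟩, ?_⟩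
      rintro _ ⟨s, hs, rfl⟩
      have hs' : t ≤ s := hs
      rcases le_total (s - t) K with h | h
      · have := hr' (show s - t ∈ Set.Icc 0 K from ⟨by linarith, h⟩)
        have h2 := e (s - t) (by linarith)
        simp only [add_sub_cancel] at h2
        simp only [Set.mem_ofPred_eq] at this
        simp only
        linarith
      · have := hr' (show (0:ℝ) ∈ Set.Icc 0 K from ⟨le_rfl, hK0⟩)
        have h2 := e 0 le_rfl
        simp only [Set.mem_ofPred_eq] at this
        simp only [add_zero, sub_self, mul_zero, sub_zero] at h2
        have h3 := abs_le.1 (hW x t)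
        have h4 := abs_le.1 (hW x s)
        have h5 : μ * (2 * W) ≤ μ * (η * (s - t)) := by
          rw [← hKη]; gcongr
        have h6 : μ * (u x t - v x - (u x s - v x)) ≤ μ * (2 * W) := by
          apply mul_le_mul_of_nonneg_left _ hμ.le; linarith
        simp only
        nlinarith
  refine ⟨⟨fun q => sSup (f q '' Set.Icc 0 K), ?_, ?_⟩, ?_, hle⟩
  · exact isCompact_Icc.continuous_sSup hfc
  · intro x t ht
    obtain ⟨r, hr, h1, h2⟩ := key x t ht
    exact h2.trans h1.symm
  · intro x t ht
    obtain ⟨r, hr, h1, h2⟩ := key x t ht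
    refine ⟨t + r, by linarith [hr.1], ?_⟩
    rw [h2]
    simp [hf, max_eq_left ht, max_eq_left hr.1]

/-- The one-dimensional argument. -/
lemma time_arg (y : ℝ → ℝ) (μ η Y : ℝ) (hη : 0 < η) (hμ : 1 < μ)
    (hc : ContinuousOn y (Set.Ici 0)) (hY : ∀ t, 0 < t → y t ≤ Y) (h0 : ∀ t, 0 < t → 0 ≤ y t)
    (hle : ∀ t s, 0 < t → t ≤ s → y t ≤ μ * (y s + η * (s - t)))
    (hex : ∀ t, 0 < t → ∃ s, t ≤ s ∧ y t = μ * (y s + η * (s - t))) :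
    ∀ t, 1 + Y / (μ * η) ≤ t → y t = 0 := by
  have key : ∀ t, 0 < t → ∃ s, t ≤ s ∧ y s = 0 ∧ y t = μ * (η * (s - t)) := by
    intro t ht
    obtain ⟨s, hs, h1⟩ := hex t ht
    obtain ⟨s', hs', h2⟩ := hex s (by linarith)
    have h3 := hle t s' ht (by linarith)
    have h4 := h0 s (by linarith)
    -- y s = μ (y s' + η (s' - s)), and y s + η s ≤ y s' + η s'
    have h5 : y s + η * (s - t) ≤ y s' + η * (s' - t) := by
      rw [h1] at h3; exact le_of_mul_le_mul_left h3 (by linarith)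
    have h6 : y s = 0 := by nlinarith
    exact ⟨s, hs, h6, by rw [h1, h6, zero_add]⟩
  have hμη : 0 < μ * η := by positivity
  obtain ⟨t0, ht0, hz0, he0⟩ := key 1 one_pos
  have ht0' : t0 ≤ 1 + Y / (μ * η) := by
    have := hY 1 one_pos
    rw [he0] at this
    have : t0 - 1 ≤ Y / (μ * η) := by rw [le_div_iff₀ hμη]; linarith
    linarith
  intro t1 ht1
  by_contra hne
  have ht01 : t0 ≤ t1 := ht0'.trans ht1
  set S := {t | t ∈ Set.Icc t0 t1 ∧ y t = 0} with hS
  have hSc : IsCompact S := by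
    have hcc : ContinuousOn y (Set.Icc t0 t1) := hc.mono fun t ht => by
      have := ht.1; simp; linarith
    have : IsClosed S := hcc.preimage_isClosed_of_isClosed isClosed_Icc (isClosed_singleton (x := (0:ℝ)))
    exact isCompact_Icc.of_isClosed_subset this fun t ht => ht.1
  obtain ⟨a, ha, hamax⟩ := hSc.exists_isGreatest ⟨t0, ⟨le_rfl, ht01⟩, hz0⟩
  have hat : a < t1 := lt_of_le_of_ne ha.1.2 fun h => hne (h ▸ ha.2)
  have ha0 : 0 < a := by linarith [ha.1.1]
  have hlow : ∀ t ∈ Set.Ioo a t1, μ * (η * (t1 - t)) ≤ y t := by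
    intro t ht
    obtain ⟨s, hs, hs0, hse⟩ := key t (ha0.trans ht.1)
    have : t1 ≤ s := by
      by_contra hlt
      have := hamax (show s ∈ S from ⟨⟨by linarith [ha.1.1, ht.1], by linarith⟩, hs0⟩)
      linarith [ht.1]
    rw [hse]
    gcongr
  have hlim : Tendsto y (nhdsWithin a (Set.Ioo a t1)) (nhds (y a)) :=
    (hc a ha0.le).mono_left (nhdsWithin_mono _ fun t ht => by simp; linarith [ht.1])
  have hlim2 : Tendsto (fun t => μ * (η * (t1 - t))) (nhdsWithin a (Set.Ioo a t1)) (nhds (μ * (η * (t1 - a)))) :=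
    (Continuous.tendsto (by fun_prop) a).mono_left nhdsWithin_le_nhds
  have : (nhdsWithin a (Set.Ioo a t1)).NeBot := by
    rw [nhdsWithin_Ioo_eq_nhdsGT hat]; infer_instance
  have := le_of_tendsto_of_tendsto hlim2 hlim (eventually_nhdsWithin_of_forall hlow)
  rw [ha.2] at this
  have : 0 < μ * (η * (t1 - a)) := by
    have : 0 < t1 - a := by linarith
    positivity
  linarith

lemma strong_max {Θ : Type*} [Nonempty Θ] (A : Θ → E N → Matrix (Fin N) (Fin N) ℝ) (C₀ : ℝ) (hC₀ : 0 ≤ C₀)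
    (U : E N → ℝ → ℝ) (Q : E N × ℝ → ℝ) (hQc : Continuous Q)
    (hQ : ∀ x t, 0 ≤ t → U x t = Q (x, t)) (m : ℝ) (hm : 0 < m)
    (hle : ∀ x t, 0 ≤ t → U x t ≤ m) (hsub : IsSubSolMinIneq A C₀ U)
    (T : ℝ) (hT0 : 0 ≤ T) (hT : ∀ θ x, (A θ x).trace ≤ T)
    (τ : ℝ) (hτ : 0 < τ) (x₁ : E N) (hx₁ : U x₁ τ = m) (r : ℝ) (hr : 0 < r) (ν : ℝ) (hν : 0 < ν)
    (hell : ∀ θ x, dist x x₁ ≤ 2 * r → (A θ x - ν • (1 : Matrix (Fin N) (Fin N) ℝ)).PosSemidef)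
    (x₀ : E N) (hx₀ : dist x₀ x₁ < r) : U x₀ τ = m := by
  by_contra hne
  have hlt : Q (x₀, τ) < m := by
    rw [← hQ _ _ hτ.le]; exact lt_of_le_of_ne (hle _ _ hτ.le) hne
  obtain ⟨κ, hκ⟩ : ∃ κ, κ = (m - Q (x₀, τ)) / 2 := ⟨_, rfl⟩
  have hκ0 : 0 < κ := by rw [hκ]; linarith
  obtain ⟨ρ, ε, hρ, hε, hετ, hnear⟩ : ∃ ρ ε : ℝ, 0 < ρ ∧ 0 < ε ∧ ε < τ ∧
      ∀ x t, dist x x₀ ≤ ρ → |t - τ| ≤ ε → Q (x, t) ≤ m - κ := by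
    have ho : ∀ᶠ q in nhds (x₀, τ), Q q < m - κ :=
      hQc.continuousAt.eventually_lt continuousAt_const (by rw [hκ]; linarith)
    obtain ⟨d, hd, hd'⟩ := Metric.eventually_nhds_iff.1 ho
    refine ⟨d / 2, min (d / 2) (τ / 2), by positivity, by positivity,
      (min_le_right _ _).trans_lt (by linarith), fun x t hx ht => (hd' ?_).le⟩
    rw [Prod.dist_eq]
    refine max_lt (by simp only; linarith) ?_
    have := ht.trans (min_le_left _ _)
    rw [Real.dist_eq]; simp only; linarith
  obtain ⟨b, hb⟩ : ∃ b, b = (r^2/ε + T + C₀ * r + 1) / (2 * ν * ρ^2) := ⟨_, rfl⟩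
  have hb0 : 0 < b := by rw [hb]; positivity
  have hb1 : 2 * b * ν * ρ^2 = r^2/ε + T + C₀ * r + 1 := by rw [hb]; field_simp
  obtain ⟨c, hc⟩ : ∃ c, c = b * r^2 / ε^2 := ⟨_, rfl⟩
  have hc0 : 0 < c := by rw [hc]; positivity
  have hcε : c * ε^2 = b * r^2 := by rw [hc]; field_simp
  obtain ⟨δ, hδ⟩ : ∃ δ, δ = min κ m := ⟨_, rfl⟩
  have hδ0 : 0 < δ := by rw [hδ]; exact lt_min hκ0 hm
  have hδκ : δ ≤ κ := by rw [hδ]; exact min_le_left _ _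
  have hδm : δ ≤ m := by rw [hδ]; exact min_le_right _ _
  obtain ⟨e₀, he₀⟩ : ∃ e₀, e₀ = Real.exp (-(b * r^2)) := ⟨_, rfl⟩
  have he₀0 : 0 < e₀ := by rw [he₀]; exact Real.exp_pos _
  obtain ⟨φ, hφ⟩ : ∃ φ : E N → ℝ → ℝ, φ = fun x t =>
    m - δ * (Real.exp (-(b * ‖x - x₀‖^2 + c * (t - τ)^2)) - e₀) := ⟨_, rfl⟩
  have hφC : ContDiff ℝ 2 (fun q : E N × ℝ => φ q.1 q.2) := by
    have h1 : ContDiff ℝ 2 (fun q : E N × ℝ => ‖q.1 - x₀‖^2) :=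
      (contDiff_fst.sub contDiff_const).norm_sq ℝ
    rw [hφ]
    fun_prop
  -- maximum on the cylinder
  set K : Set (E N × ℝ) := Metric.closedBall x₀ r ×ˢ Set.Icc (τ - ε) (τ + ε) with hK
  have hKc : IsCompact K := (isCompact_closedBall x₀ r).prod isCompact_Icc
  have hx1K : (x₁, τ) ∈ K := by
    refine ⟨?_, by constructor <;> linarith⟩
    rw [Metric.mem_closedBall, dist_comm]; exact hx₀.le
  obtain ⟨⟨x, t⟩, hxt, hmax⟩ := hKc.exists_isMaxOn (f := fun q : E N × ℝ => Q q - φ q.1 q.2) ⟨_, hx1K⟩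
    ((hQc.sub hφC.continuous).continuousOn)
  have hpos : 0 < Q (x, t) - φ x t := by
    have h1 : Q (x₁, τ) - φ x₁ τ ≤ Q (x, t) - φ x t := hmax hx1K
    refine lt_of_lt_of_le ?_ h1
    rw [← hQ _ _ hτ.le, hx₁, hφ]
    have : e₀ < Real.exp (-(b * ‖x₁ - x₀‖^2 + c * (τ - τ)^2)) := by
      rw [he₀]
      apply Real.exp_lt_exp.2
      have : ‖x₁ - x₀‖ < r := by rw [← dist_eq_norm, dist_comm]; exact hx₀
      have : ‖x₁ - x₀‖^2 < r^2 := pow_lt_pow_left₀ this (norm_nonneg _) (by norm_num)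
      have := mul_lt_mul_of_pos_left this hb0
      simp only [sub_self]
      linarith
    have := mul_pos hδ0 (sub_pos.2 this)
    simp only
    linarith
  have ht1 : τ - ε ≤ t := hxt.2.1
  have ht2 : t ≤ τ + ε := hxt.2.2
  have ht0 : 0 < t := by linarith
  have htε : |t - τ| ≤ ε := abs_le.2 ⟨by linarith, by linarith⟩
  obtain ⟨e, he⟩ : ∃ e, e = Real.exp (-(b * ‖x - x₀‖^2 + c * (t - τ)^2)) := ⟨_, rfl⟩
  have hepos : 0 < e := by rw [he]; exact Real.exp_pos _
  have hφe : φ x t = m - δ * (e - e₀) := by rw [he, hφ]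
  have he1 : e ≤ 1 := by
    rw [he]; apply Real.exp_le_one_iff.2
    have : 0 ≤ b * ‖x - x₀‖^2 + c * (t - τ)^2 := by positivity
    linarith
  have hQm : Q (x, t) ≤ m := by rw [← hQ _ _ ht0.le]; exact hle _ _ ht0.le
  have hee : e₀ < e := by
    by_contra hcon
    have : δ * (e - e₀) ≤ 0 := mul_nonpos_of_nonneg_of_nonpos hδ0.le (by linarith)
    linarith
  have hq : b * ‖x - x₀‖^2 + c * (t - τ)^2 < b * r^2 := by
    rw [he, he₀, Real.exp_lt_exp] at hee; linarith
  have hδe : δ * (e - e₀) < δ := by nlinarith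
  have hUpos : 0 < U x t := by rw [hQ _ _ ht0.le]; linarith
  have hρx : ρ < ‖x - x₀‖ := by
    by_contra hcon
    have := hnear x t (by rw [dist_eq_norm]; linarith) htε
    linarith
  have hxr : ‖x - x₀‖ < r := by
    have h1 : 0 ≤ c * (t - τ)^2 := by positivity
    have h2 : b * ‖x - x₀‖^2 < b * r^2 := by linarith
    exact lt_of_pow_lt_pow_left₀ 2 hr.le (lt_of_mul_lt_mul_left h2 hb0.le)
  have htε' : |t - τ| < ε := by
    have h1 : 0 ≤ b * ‖x - x₀‖^2 := by positivity
    have h2 : c * (t - τ)^2 < c * ε^2 := by linarith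
    exact abs_lt_of_sq_lt_sq (lt_of_mul_lt_mul_left h2 hc0.le) hε.le
  have hloc : IsLocalMax (fun q : E N × ℝ => U q.1 q.2 - φ q.1 q.2) (x, t) := by
    have hn : K ∈ nhds (x, t) := by
      apply prod_mem_nhds
      · exact mem_of_superset (Metric.isOpen_ball.mem_nhds (by rw [Metric.mem_ball, dist_eq_norm]; exact hxr))
          Metric.ball_subset_closedBall
      · have := abs_lt.1 htε'
        exact Icc_mem_nhds (by linarith) (by linarith)
    filter_upwards [hn] with q hqK
    have h1 : 0 ≤ q.2 := by have := hqK.2.1; linarith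
    have h2 := hmax hqK
    simp only [Set.mem_ofPred_eq] at h2
    rw [hQ q.1 q.2 h1, hQ x t ht0.le]
    exact h2
  rcases hsub φ hφC x t ht0 hloc with h | h
  · linarith
  have hder : deriv (φ x) t = δ * e * (2 * c * (t - τ)) := by
    have h1 : HasDerivAt (fun t : ℝ => b * ‖x - x₀‖^2 + c * (t - τ)^2) (c * (2 * (t - τ))) t := by
      have := (((hasDerivAt_id t).sub_const τ).pow 2).const_mul c |>.const_add (b * ‖x - x₀‖^2)
      simpa using this
    have h2 := ((h1.neg.exp.sub_const e₀).const_mul δ).const_sub m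
    have h3 : HasDerivAt (φ x) (δ * e * (2 * c * (t - τ))) t := by
      rw [hφ, he]
      refine h2.congr_deriv ?_
      simp only [Pi.neg_apply]
      ring
    exact h3.deriv
  have hgr : gradient (fun y => φ y t) x = (δ * e * (2 * b)) • (x - x₀) := by
    rw [hφ, he]; exact grad_bar x₀ m δ b (c * (t - τ)^2) e₀ x
  have hhe : hessMatrix (fun y => φ y t) x = (δ * e * (2 * b)) •
        ((1 : Matrix (Fin N) (Fin N) ℝ) - (2 * b) • Matrix.vecMulVec (x - x₀).ofLp (x - x₀).ofLp) := by
    rw [hφ, he]; exact hess_bar x₀ m δ b (c * (t - τ)^2) e₀ x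
  have hδeb : 0 < δ * e * (2 * b) := by positivity
  have hinf : δ * e * (2 * b) * (2 * b * (ν * ρ^2) - T) ≤
      ⨅ θ, -Matrix.trace (A θ x * hessMatrix (fun y => φ y t) x) := by
    apply le_ciInf
    intro θ
    rw [hhe, trace_quad]
    have h1 := quad_lower (A θ x) ν (hell θ x (by
      have := dist_triangle x x₀ x₁
      rw [← dist_eq_norm] at hxr
      linarith)) (x - x₀)
    have h2 := hT θ x
    have h3 : ν * ρ^2 ≤ ν * ‖x - x₀‖^2 := by gcongr
    have h4 : 2 * b * (ν * ρ^2) ≤ 2 * b * ((x - x₀).ofLp ⬝ᵥ (A θ x *ᵥ (x - x₀).ofLp)) :=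
      mul_le_mul_of_nonneg_left (h3.trans h1) (by positivity)
    rw [← mul_neg]
    apply mul_le_mul_of_nonneg_left _ hδeb.le
    linarith
  rw [hder, hgr, norm_smul, Real.norm_of_nonneg hδeb.le] at h
  have h5 : C₀ * (δ * e * (2 * b) * ‖x - x₀‖) ≤ δ * e * (2 * b) * (C₀ * r) := by
    have : C₀ * ‖x - x₀‖ ≤ C₀ * r := by gcongr
    have := mul_le_mul_of_nonneg_left this hδeb.le
    linarith
  have h6 : -(δ * e * (2 * b) * (r^2 / ε)) ≤ δ * e * (2 * c * (t - τ)) := by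
    have h7 : -ε ≤ t - τ := by linarith
    have h8 : c * ε = b * (r^2 / ε) := by rw [hc]; field_simp
    have h9 : 2 * c * (-ε) ≤ 2 * c * (t - τ) := mul_le_mul_of_nonneg_left h7 (by positivity)
    have := mul_le_mul_of_nonneg_left h9 (show 0 ≤ δ * e by positivity)
    have h10 : δ * e * (2 * c * (-ε)) = -(δ * e * (2 * b) * (r^2 / ε)) := by
      linear_combination (-2 * δ * e) * h8
    linarith
  have h11 : δ * e * (2 * b) * (2 * b * (ν * ρ^2) - T) - δ * e * (2 * b) * (r^2 / ε)
      - δ * e * (2 * b) * (C₀ * r) = δ * e * (2 * b) := by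
    linear_combination (δ * e * (2 * b)) * hb1
  linarith

theorem statement10
    {N : ℕ} {Θ : Type*} [MetricSpace Θ] [Nonempty Θ]
    (C : ℝ) (hC : 0 < C)
    (σm : Θ → E N → Matrix (Fin N) (Fin N) ℝ)
    (A : Θ → E N → Matrix (Fin N) (Fin N) ℝ)
    -- (H1)
    (hA : ∀ (θ : Θ) (x : E N), A θ x = σm θ x * (σm θ x)ᵀ)
    (hσper : ∀ θ : Θ, ZPeriodic (σm θ))
    (hσbd : ∀ (θ : Θ) (x : E N) (i j : Fin N), |σm θ x i j| ≤ C)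
    (hσlip : ∀ (θ : Θ) (i j : Fin N), LipschitzWith C.toNNReal fun x : E N => σm θ x i j)
    (H : Θ → E N → E N → ℝ)
    -- (H2)
    (hHper : ∀ (θ : Θ) (p : E N), ZPeriodic fun x => H θ x p)
    (hH0 : ∀ (θ : Θ) (x : E N), |H θ x 0| ≤ C)
    (hHlip : ∀ R > (0:ℝ), ∃ CR > (0:ℝ), ∀ (θ : Θ) (x y p q : E N),
      ‖p‖ ≤ R → ‖q‖ ≤ R → |H θ x p - H θ y q| ≤ CR * (‖x - y‖ + ‖p - q‖))
    -- (inver_dege)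
    (hell : InverDege A)
    -- ut : bounded Lipschitz solution of (CP); v : bounded Lipschitz solution of the
    -- ergodic equation, normalized so that c = 0
    (ut : E N → ℝ → ℝ)
    (hutper : ∀ t : ℝ, ZPeriodic fun x => ut x t)
    (hutcont : ContinuousOn (fun q : E N × ℝ => ut q.1 q.2) (Set.univ ×ˢ Set.Ici 0))
    (hutbd : ∃ Cb : ℝ, ∀ (x : E N) (t : ℝ), |ut x t| ≤ Cb)
    (hutsol : IsSolCP A H ut)
    (hutlip : ∀ t : ℝ, 0 ≤ t → LipschitzWith C.toNNReal fun x => ut x t)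
    (v : E N → ℝ) (hvper : ZPeriodic v)
    (hvbd : ∃ Cb : ℝ, ∀ x : E N, |v x| ≤ Cb)
    (hvlip : ∃ L : NNReal, LipschitzWith L v)
    (hverg : IsSolErg A H 0 v)
    (η μ : ℝ) (hη : 0 < η) (hμ : 1 < μ)
    -- M_{ημ}[ut] ≡ m > 0
    (m : ℝ) (hm : ∀ t : ℝ, 0 ≤ t → Mfun ut v η μ t = m) (hmpos : 0 < m)
    -- M_{η1}[ut] ≡ m₁
    (m₁ : ℝ) (hm₁ : ∀ t : ℝ, 0 ≤ t → Mfun ut v η 1 t = m₁)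
    -- P_{ημ}[ut] subsolution of the linearized min-inequality
    (C₀ : ℝ) (hC₀ : 0 ≤ C₀)
    (hPsub : IsSubSolMinIneq A C₀ (Pfun ut v η μ)) :
    ((degenSet A).Nonempty → ∀ τ > (0:ℝ), ∃ xτ ∈ degenSet A,
      Pfun ut v η μ xτ τ = m ∧ ∀ (x : E N) (t : ℝ), 0 ≤ t → Pfun ut v η μ x t ≤ m) ∧
    (degenSet A = ∅ → m₁ = 0) := by
  obtain ⟨L, hL⟩ := hvlip
  obtain ⟨B₁, hB₁⟩ := hutbd
  obtain ⟨B₂, hB₂⟩ := hvbd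
  have hW : ∀ x t, |ut x t - v x| ≤ B₁ + B₂ := fun x t =>
    (abs_sub _ _).trans (add_le_add (hB₁ x t) (hB₂ x))
  have hμ0 : 0 < μ := by linarith
  obtain ⟨⟨Q, hQc, hQ⟩, hatt, hlow⟩ := P_props ut v hutcont hL.continuous (B₁ + B₂) hW η μ hη hμ0
  have hW0 : 0 ≤ B₁ + B₂ := (abs_nonneg _).trans (hW 0 0)
  have hPm : ∀ (x : E N) (t : ℝ), 0 ≤ t → Pfun ut v η μ x t ≤ m := by
    intro x t ht
    rw [← hm t ht]
    refine le_csSup ⟨(B₁ + B₂) + μ * (B₁ + B₂), ?_⟩ ⟨x, rfl⟩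
    rintro _ ⟨x, rfl⟩
    obtain ⟨s, hs, he⟩ := hatt x t ht
    simp only [he]
    have h1 := abs_le.1 (hW x t)
    have h2 := abs_le.1 (hW x s)
    have h3 : 0 ≤ μ * η * (s - t) := mul_nonneg (by positivity) (sub_nonneg.2 hs)
    have h4 : -(μ * (B₁ + B₂)) ≤ μ * (ut x s - v x) := by nlinarith
    linarith
  -- attainment
  have hmaxat : ∀ τ > (0:ℝ), ∃ x, Pfun ut v η μ x τ = m := by
    intro τ hτ
    have hcube : IsCompact (cube N) := by
      have h1 : IsCompact (Set.pi Set.univ fun _ : Fin N => Set.Icc (0:ℝ) 1) :=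
        isCompact_univ_pi fun _ => isCompact_Icc
      have h2 := h1.image (PiLp.continuous_toLp 2 (fun _ : Fin N => ℝ))
      convert h2 using 1
      ext x
      constructor
      · intro hx
        exact ⟨x.ofLp, fun i _ => hx i, rfl⟩
      · rintro ⟨y, hy, rfl⟩ i
        exact hy i trivial
    have hne : (cube N).Nonempty := ⟨0, fun i => by simp⟩
    obtain ⟨x, hx, hxm⟩ := hcube.exists_isMaxOn (f := fun x => Q (x, τ)) hne
      (hQc.comp (by fun_prop)).continuousOn
    refine ⟨x, le_antisymm (hPm x τ hτ.le) ?_⟩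
    rw [← hm τ hτ.le]
    refine csSup_le (Set.range_nonempty _) ?_
    rintro _ ⟨y, rfl⟩
    set k : Fin N → ℤ := fun i => -⌊y i⌋ with hk
    set z : E N := y + (WithLp.equiv 2 (Fin N → ℝ)).symm fun i => (k i : ℝ) with hz
    have hzc : z ∈ cube N := by
      intro i
      have : z i = Int.fract (y i) := by
        simp [hz, hk, Int.fract, sub_eq_add_neg]
      rw [this]
      exact ⟨Int.fract_nonneg _, (Int.fract_lt_one _).le⟩
    have hPz : Pfun ut v η μ z τ = Pfun ut v η μ y τ := by
      have h1 : ∀ t, ut z t = ut y t := fun t => hutper t y k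
      have h2 : v z = v y := hvper y k
      simp only [Pfun, h1, h2]
    simp only
    rw [← hPz, hQ z τ hτ.le, hQ x τ hτ.le]
    exact hxm hzc
  have hSgc : IsClosed (degenSet A) := by
    have hAc : ∀ θ, Continuous (A θ) := by
      intro θ
      have h1 : Continuous (σm θ) := continuous_matrix fun i j => (hσlip θ i j).continuous
      have : A θ = fun x => σm θ x * (σm θ x)ᵀ := funext (hA θ)
      rw [this]
      exact h1.matrix_mul h1.matrix_transpose
    have : degenSet A = ⋂ θ, (A θ) ⁻¹' {0} := by ext x; simp [degenSet]
    rw [this]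
    exact isClosed_iInter fun θ => isClosed_singleton.preimage (hAc θ)
  have hT : ∀ θ x, (A θ x).trace ≤ N * (N * C^2) := by
    intro θ x
    rw [hA]; exact trace_upper _ C (hσbd θ x)
  -- local propagation
  have hprop : ∀ τ > (0:ℝ), ∀ x₁ ∉ degenSet A, Pfun ut v η μ x₁ τ = m →
      ∀ᶠ x in nhds x₁, Pfun ut v η μ x τ = m := by
    intro τ hτ x₁ hx₁ hPx
    obtain ⟨d, hd, hdb⟩ := Metric.isOpen_iff.1 hSgc.isOpen_compl x₁ hx₁
    have hr : 0 < d / 4 := by positivity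
    obtain ⟨ν, hν, hνA⟩ := hell (d / 4) hr
    filter_upwards [Metric.ball_mem_nhds x₁ hr] with x₀ hx₀
    refine strong_max A C₀ hC₀ (Pfun ut v η μ) Q hQc hQ m hmpos hPm hPsub (N * (N * C^2))
      (by positivity) hT τ hτ x₁ hPx (d / 4) hr ν hν (fun θ x hx => hνA θ x fun y hy => ?_) x₀ hx₀
    have h1 : d ≤ dist y x₁ := by
      by_contra hcon
      exact hdb (show y ∈ Metric.ball x₁ d by rw [Metric.mem_ball]; linarith) hy
    have h2 := dist_triangle y x x₁
    rw [dist_comm y x] at h2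
    linarith
  have hall : ∀ τ > (0:ℝ), (∀ x ∈ degenSet A, Pfun ut v η μ x τ ≠ m) →
      ∀ x, Pfun ut v η μ x τ = m := by
    intro τ hτ hno
    have hcl : IsClosed {x | Pfun ut v η μ x τ = m} := by
      have : {x | Pfun ut v η μ x τ = m} = {x | Q (x, τ) = m} := by
        ext x; simp [hQ x τ hτ.le]
      rw [this]
      exact isClosed_eq (hQc.comp (by fun_prop)) continuous_const
    have hop : IsOpen {x | Pfun ut v η μ x τ = m} := by
      rw [isOpen_iff_mem_nhds]
      intro x hx
      exact hprop τ hτ x (fun hxSg => hno x hxSg hx) hx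
    have := IsClopen.eq_univ ⟨hcl, hop⟩ (hmaxat τ hτ)
    intro x
    have hx : x ∈ {x | Pfun ut v η μ x τ = m} := by rw [this]; trivial
    exact hx
  refine ⟨?_, ?_⟩
  · rintro ⟨z, hz⟩ τ hτ
    by_contra hcon
    have hno : ∀ x ∈ degenSet A, Pfun ut v η μ x τ ≠ m := fun x hx h => hcon ⟨x, hx, h, hPm⟩
    exact hno z hz (hall τ hτ hno z)
  · intro hSg
    have hconst : ∀ x t, 0 < t → Pfun ut v η μ x t = m := fun x t ht =>
      hall t ht (by simp [hSg]) x
    obtain ⟨Lc, hLc⟩ : ∃ Lc, Lc = -m / (μ - 1) := ⟨_, rfl⟩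
    have hμ1 : 0 < μ - 1 := by linarith
    have hLeq : Lc = m + μ * Lc := by
      rw [hLc]; field_simp; ring
    obtain ⟨T, hTdef⟩ : ∃ T, T = 1 + (B₁ + B₂ - Lc) / (μ * η) := ⟨_, rfl⟩
    have hzero : ∀ x t, T ≤ t → ut x t - v x - Lc = 0 := by
      intro x t ht
      rw [hTdef] at ht
      refine time_arg (fun t => ut x t - v x - Lc) μ η (B₁ + B₂ - Lc) hη hμ ?_ ?_ ?_ ?_ ?_ t ht
      · have : ContinuousOn (fun t : ℝ => ut x t) (Set.Ici 0) := by
          have := hutcont.comp (f := fun t : ℝ => (x, t)) (s := Set.Ici 0) (by fun_prop)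
            (fun t ht => ⟨trivial, ht⟩)
          exact this
        exact (this.sub continuousOn_const).sub continuousOn_const
      · intro t _
        have := abs_le.1 (hW x t)
        linarith
      · intro t ht
        have := hlow x t t le_rfl
        rw [hconst x t ht] at this
        by_contra hneg
        nlinarith
      · intro t s ht hs
        have := hlow x t s hs
        rw [hconst x t ht] at this
        linarith
      · intro t ht
        obtain ⟨s, hs, he⟩ := hatt x t ht.le
        refine ⟨s, hs, ?_⟩
        rw [hconst x t ht] at he
        linarith
    have ht0 : 0 ≤ max T 0 := le_max_right _ _
    rw [← hm₁ (max T 0) ht0]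
    have hP1 : ∀ x, Pfun ut v η 1 x (max T 0) = 0 := by
      intro x
      apply IsGreatest.csSup_eq
      refine ⟨⟨max T 0, by simp, by simp⟩, ?_⟩
      rintro _ ⟨s, hs, rfl⟩
      have hs' : max T 0 ≤ s := hs
      have h1 := hzero x (max T 0) (le_max_left _ _)
      have h2 := hzero x s ((le_max_left _ _).trans hs')
      have h3 : 0 ≤ η * (s - max T 0) := mul_nonneg hη.le (by linarith)
      simp only
      linarith
    simp [Mfun, hP1]

end LargeTimeBehavior
end
end

section
/- Assume (H1)–(H2) and let u: 𝕋^N×[0,∞) → ℝ be a bounded continuous viscosity subsolution of the Cauchy problem (CP), Lipschitz in x uniformly in t. Let K ⊂ Σ be a set such that H_θ(x,p) ≥ 0 for all (x,p) ∈ K×ℝ^N and all θ∈Θ (i.e. condition (H10)(ii)(a) normalized to ergodic constant c=0). Then for every x₀ ∈ K, the function t ↦ u(x₀,t) is nonincreasing on [0,∞). -/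
open Filter
open scoped RealInnerProductSpace Matrix

noncomputable section

namespace LargeTimeBehavior

variable {N : ℕ} {Θ : Type*}

theorem test_hasFDerivAt (x₀ : E N) (M c : ℝ) (y : E N) :
    HasFDerivAt (fun y : E N => M * ‖y - x₀‖ ^ 2 + c) ((2 * M) • innerSL ℝ (y - x₀)) y := by
  have h1 : HasFDerivAt (fun y : E N => y - x₀) (ContinuousLinearMap.id ℝ (E N)) y :=
    (hasFDerivAt_id y).sub_const x₀
  have h2 := ((h1.norm_sq).const_mul M).add_const c
  refine h2.congr_fderiv ?_
  ext v
  simp only [ContinuousLinearMap.smul_apply, ContinuousLinearMap.comp_apply,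
    ContinuousLinearMap.id_apply, innerSL_apply_apply, smul_eq_mul, nsmul_eq_mul]
  push_cast
  ring

theorem test_gradient (x₀ : E N) (M c : ℝ) (y : E N) :
    gradient (fun y : E N => M * ‖y - x₀‖ ^ 2 + c) y = (2 * M) • (y - x₀) := by
  apply HasGradientAt.gradient
  rw [hasGradientAt_iff_hasFDerivAt]
  refine (test_hasFDerivAt x₀ M c y).congr_fderiv ?_
  ext v
  simp only [ContinuousLinearMap.smul_apply, innerSL_apply_apply, smul_eq_mul,
    InnerProductSpace.toDual_apply_apply, real_inner_smul_left]

theorem test_hess (x₀ : E N) (M c : ℝ) (x : E N) :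
    hessMatrix (fun y : E N => M * ‖y - x₀‖ ^ 2 + c) x = (2 * M) • (1 : Matrix (Fin N) (Fin N) ℝ) := by
  ext i j
  have h0 : (fun y : E N => fderiv ℝ (fun y : E N => M * ‖y - x₀‖ ^ 2 + c) y
      (EuclideanSpace.single j 1)) = fun y : E N => (2 * M) * inner ℝ (y - x₀) (EuclideanSpace.single j (1:ℝ)) := by
    funext y
    rw [(test_hasFDerivAt x₀ M c y).fderiv]
    simp only [ContinuousLinearMap.smul_apply, innerSL_apply_apply, smul_eq_mul]
  have h1 : HasFDerivAt (fun y : E N => (2 * M) * inner ℝ (y - x₀) (EuclideanSpace.single j (1:ℝ)))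
      ((2 * M) • innerSL ℝ (EuclideanSpace.single j (1:ℝ))) x := by
    have h2 : HasFDerivAt (fun y : E N => y - x₀) (ContinuousLinearMap.id ℝ (E N)) x :=
      (hasFDerivAt_id x).sub_const x₀
    have h3 := (h2.inner ℝ (hasFDerivAt_const (EuclideanSpace.single j (1:ℝ)) x)).const_mul (2 * M)
    refine h3.congr_fderiv ?_
    ext v
    simp [real_inner_comm]
  unfold hessMatrix
  rw [Matrix.of_apply, h0, h1.fderiv]
  simp [Matrix.one_apply, EuclideanSpace.inner_single_left, eq_comm]

theorem sigma_zero (S : Matrix (Fin N) (Fin N) ℝ) (h : S * Sᵀ = 0) : S = 0 := by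
  have : S * Sᴴ = 0 := by simpa [Matrix.conjTranspose_eq_transpose_of_trivial] using h
  exact Matrix.self_mul_conjTranspose_eq_zero.1 this

theorem trace_le (S : Matrix (Fin N) (Fin N) ℝ) (b : ℝ) (h : ∀ i j, |S i j| ≤ b) :
    Matrix.trace (S * Sᵀ) ≤ (N:ℝ) ^ 2 * b ^ 2 := by
  have h1 : Matrix.trace (S * Sᵀ) = ∑ i, ∑ j, S i j ^ 2 := by
    simp [Matrix.trace, Matrix.mul_apply, sq]
  rw [h1]
  calc ∑ i, ∑ j, S i j ^ 2 ≤ ∑ i : Fin N, ∑ j : Fin N, b ^ 2 := by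
        refine Finset.sum_le_sum fun i _ => Finset.sum_le_sum fun j _ => ?_
        exact sq_le_sq' (abs_le.1 (h i j)).1 (abs_le.1 (h i j)).2
    _ = _ := by simp; ring

set_option maxHeartbeats 2000000 in
theorem statement12
    {N : ℕ} {Θ : Type*} [MetricSpace Θ] [Nonempty Θ]
    (C : ℝ) (hC : 0 < C)
    (σm : Θ → E N → Matrix (Fin N) (Fin N) ℝ)
    (A : Θ → E N → Matrix (Fin N) (Fin N) ℝ)
    -- (H1)
    (hA : ∀ (θ : Θ) (x : E N), A θ x = σm θ x * (σm θ x)ᵀ)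
    (hσper : ∀ θ : Θ, ZPeriodic (σm θ))
    (hσbd : ∀ (θ : Θ) (x : E N) (i j : Fin N), |σm θ x i j| ≤ C)
    (hσlip : ∀ (θ : Θ) (i j : Fin N), LipschitzWith C.toNNReal fun x : E N => σm θ x i j)
    (H : Θ → E N → E N → ℝ)
    -- (H2)
    (hHper : ∀ (θ : Θ) (p : E N), ZPeriodic fun x => H θ x p)
    (hH0 : ∀ (θ : Θ) (x : E N), |H θ x 0| ≤ C)
    (hHlip : ∀ R > (0:ℝ), ∃ CR > (0:ℝ), ∀ (θ : Θ) (x y p q : E N),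
      ‖p‖ ≤ R → ‖q‖ ≤ R → |H θ x p - H θ y q| ≤ CR * (‖x - y‖ + ‖p - q‖))
    -- u : bounded continuous subsolution of (CP), Lipschitz in x uniformly in t
    (u : E N → ℝ → ℝ)
    (huper : ∀ t : ℝ, ZPeriodic fun x => u x t)
    (hucont : ContinuousOn (fun q : E N × ℝ => u q.1 q.2) (Set.univ ×ˢ Set.Ici 0))
    (hubd : ∃ Cb : ℝ, ∀ (x : E N) (t : ℝ), |u x t| ≤ Cb)
    (husub : IsSubSolCP A H u)
    (hulip : ∃ L : NNReal, ∀ t : ℝ, 0 ≤ t → LipschitzWith L fun x => u x t)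
    -- K ⊆ Σ with H_θ ≥ 0 on K × ℝ^N ((H10)(ii)(a) with c = 0)
    (K : Set (E N)) (hKsub : K ⊆ degenSet A)
    (hKpos : ∀ θ : Θ, ∀ x ∈ K, ∀ p : E N, 0 ≤ H θ x p) :
    ∀ x₀ ∈ K, AntitoneOn (fun t => u x₀ t) (Set.Ici 0) := by
  intro x₀ hx₀ s hs t ht hst
  by_contra hcon
  simp only [not_le] at hcon
  have hs0 : (0:ℝ) ≤ s := hs
  have hst' : s < t := by
    rcases hst.lt_or_eq with h | h
    · exact h
    · subst h; exact absurd hcon (lt_irrefl _)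
  obtain ⟨Cb, hCb⟩ := hubd
  obtain ⟨L₀, hL₀⟩ := hulip
  obtain ⟨L, hLpos, hL⟩ : ∃ L : ℝ, 0 < L ∧ ∀ τ : ℝ, 0 ≤ τ → ∀ x : E N,
      u x τ - u x₀ τ ≤ L * ‖x - x₀‖ := by
    refine ⟨L₀ + 1, by positivity, fun τ hτ x => ?_⟩
    have h := (hL₀ τ hτ).dist_le_mul x x₀
    rw [Real.dist_eq, dist_eq_norm] at h
    have := le_abs_self (u x τ - u x₀ τ)
    nlinarith [norm_nonneg (x - x₀)]
  obtain ⟨CR, hCR, hCRlip⟩ := hHlip (2 * L) (by positivity)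
  have hCb0 : 0 ≤ Cb := (abs_nonneg _).trans (hCb 0 0)
  set D := u x₀ t - u x₀ s with hD
  have hDpos : 0 < D := by rw [hD]; linarith
  set k := (2 * Cb + 1) / (D / 2) with hk
  have hkpos : 0 < k := by positivity
  have hka : D / 2 * k = 2 * Cb + 1 := by rw [hk]; field_simp
  set ψ : ℝ → ℝ := fun τ => D / 2 * Real.exp (k * (τ - t)) with hψ
  have hψs : 0 < ψ s := by simp only [hψ]; positivity
  have hψt : ψ t = D / 2 := by simp [hψ]
  have hψT : D / 2 + 2 * Cb + 1 ≤ ψ (t + 1) := by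
    have := Real.add_one_le_exp k
    have h2 : ψ (t + 1) = D / 2 * Real.exp k := by simp [hψ]
    rw [h2]; nlinarith
  set c := D / 2 * (k * Real.exp (k * (s - t))) with hc
  have hcpos : 0 < c := by positivity
  set B := 2 * (N:ℝ) ^ 2 * C ^ 2 * L ^ 2 + CR * L with hB
  have hBpos : 0 < B := by positivity
  obtain ⟨M, hM1, hM2, hM3, hM4⟩ : ∃ M : ℝ, 0 < M ∧ L / M < 1 ∧ L ^ 2 / M < min (D / 2) 1 ∧ B / M < c := by
    have h1 : ∀ a : ℝ, Tendsto (fun M : ℝ => a / M) atTop (nhds 0) := fun a =>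
      tendsto_const_nhds.div_atTop tendsto_id
    have e := (eventually_gt_atTop (0:ℝ)).and (((h1 L).eventually_lt_const one_pos).and
      (((h1 (L ^ 2)).eventually_lt_const (u := min (D / 2) 1) (by positivity)).and
        ((h1 B).eventually_lt_const hcpos)))
    exact e.exists
  set φ : E N → ℝ → ℝ := fun x τ => M * ‖x - x₀‖ ^ 2 + ψ τ with hφ
  have hφsm : ContDiff ℝ 2 (fun q : E N × ℝ => φ q.1 q.2) := by
    have h1 : ContDiff ℝ 2 (fun q : E N × ℝ => ‖q.1 - x₀‖ ^ 2) :=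
      (contDiff_fst.sub contDiff_const).norm_sq ℝ
    simp only [hφ, hψ]
    fun_prop
  have hcomp : IsCompact (Metric.closedBall x₀ 1 ×ˢ Set.Icc s (t + 1) : Set (E N × ℝ)) :=
    (isCompact_closedBall x₀ 1).prod isCompact_Icc
  have hcont : ContinuousOn (fun q : E N × ℝ => u q.1 q.2 - φ q.1 q.2)
      (Metric.closedBall x₀ 1 ×ˢ Set.Icc s (t + 1)) := by
    refine (hucont.mono ?_).sub hφsm.continuous.continuousOn
    rintro ⟨x, τ⟩ ⟨_, h⟩
    exact ⟨trivial, hs0.trans h.1⟩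
  have htmem : t ∈ Set.Icc s (t + 1) := ⟨hst, by linarith⟩
  obtain ⟨⟨x, τ⟩, ⟨hx, hτ⟩, hmax⟩ := hcomp.exists_isMaxOn
    ⟨(x₀, t), Metric.mem_closedBall_self zero_le_one, htmem⟩ hcont
  have hmax' : ∀ y ∈ Metric.closedBall x₀ 1, ∀ r ∈ Set.Icc s (t + 1),
      u y r - φ y r ≤ u x τ - φ x τ := fun y hy r hr => hmax (a := (y, r)) ⟨hy, hr⟩
  simp only at hx hτ
  have hτ0 : 0 ≤ τ := hs0.trans hτ.1
  set r := ‖x - x₀‖ with hr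
  have hr0 : 0 ≤ r := norm_nonneg _
  have hLx := hL τ hτ0 x
  have hrle : r ≤ L / M := by
    have h := hmax' x₀ (Metric.mem_closedBall_self zero_le_one) τ hτ
    simp only [hφ, sub_self, norm_zero] at h
    rw [le_div_iff₀ hM1]
    by_contra hlt
    push Not at hlt
    have : 0 < r := by
      rcases hr0.lt_or_eq with h' | h'
      · exact h'
      · rw [← h'] at hlt; linarith
    nlinarith
  have hLr : L * r ≤ L ^ 2 / M := by
    calc L * r ≤ L * (L / M) := by gcongr
      _ = _ := by ring
  have hmin1 := min_le_left (D / 2) (1:ℝ)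
  have hmin2 := min_le_right (D / 2) (1:ℝ)
  have hkey := hmax' x₀ (Metric.mem_closedBall_self zero_le_one) t htmem
  simp only [hφ, sub_self, norm_zero] at hkey
  have hMr : 0 ≤ M * r ^ 2 := by positivity
  have hτs : s < τ := by
    rcases hτ.1.lt_or_eq with h | h
    · exact h
    · exfalso
      rw [← h] at hkey hLx
      nlinarith
  have hτT : τ < t + 1 := by
    rcases hτ.2.lt_or_eq with h | h
    · exact h
    · exfalso
      rw [h] at hkey hLx
      have a1 := abs_le.1 (hCb x₀ t)
      have a2 := abs_le.1 (hCb x₀ (t + 1))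
      nlinarith
  have hloc : IsLocalMax (fun q : E N × ℝ => u q.1 q.2 - φ q.1 q.2) (x, τ) := by
    refine hmax.isLocalMax ?_
    refine prod_mem_nhds ?_ (Icc_mem_nhds hτs hτT)
    refine Metric.closedBall_mem_nhds_of_mem ?_
    rw [Metric.mem_ball, dist_eq_norm]
    exact hrle.trans_lt hM2
  have hsub := husub φ hφsm x τ (hs0.trans_lt hτs) hloc
  have hderiv : deriv (φ x) τ = D / 2 * (k * Real.exp (k * (τ - t))) := by
    have h1 : HasDerivAt (fun τ : ℝ => k * (τ - t)) k τ := by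
      simpa using ((hasDerivAt_id τ).sub_const t).const_mul k
    have h2 := ((h1.exp.const_mul (D / 2)).const_add (M * ‖x - x₀‖ ^ 2)).deriv
    rw [mul_comm k]
    exact h2
  have hcle : c ≤ deriv (φ x) τ := by
    rw [hderiv, hc]
    gcongr
  have hop : ∀ θ, -(B / M) ≤ opVal A H θ x fun y => φ y τ := by
    intro θ
    unfold opVal
    simp only [hφ]
    rw [test_hess, test_gradient, hA, Matrix.mul_smul, mul_one, Matrix.trace_smul, smul_eq_mul]
    have hσ0 : σm θ x₀ = 0 := sigma_zero _ (by rw [← hA]; exact hKsub hx₀ θ)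
    have htr := trace_le (σm θ x) (C * (L / M)) (by
      intro i j
      have h := (hσlip θ i j).dist_le_mul x x₀
      rw [Real.dist_eq, dist_eq_norm, hσ0, Real.coe_toNNReal _ hC.le] at h
      simp only [Matrix.zero_apply, sub_zero] at h
      exact h.trans (by gcongr))
    have hp : ‖(2 * M) • (x - x₀)‖ ≤ 2 * L := by
      rw [norm_smul, Real.norm_eq_abs, abs_of_pos (by positivity)]
      rw [le_div_iff₀ hM1] at hrle
      nlinarith
    have hH := hCRlip θ x x₀ _ _ hp hp
    rw [sub_self, norm_zero, add_zero] at hH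
    have hH1 := (abs_le.1 hH).1
    have hH2 := hKpos θ x₀ hx₀ ((2 * M) • (x - x₀))
    have hH3 : CR * ‖x - x₀‖ ≤ CR * (L / M) := by gcongr
    have h4 : 2 * M * Matrix.trace (σm θ x * (σm θ x)ᵀ) ≤ 2 * M * ((N:ℝ) ^ 2 * (C * (L / M)) ^ 2) := by
      gcongr
    have h5 : B / M = 2 * M * ((N:ℝ) ^ 2 * (C * (L / M)) ^ 2) + CR * (L / M) := by
      rw [hB]; field_simp
    linarith
  have hsup : -(B / M) ≤ ⨆ θ, opVal A H θ x fun y => φ y τ := by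
    by_cases hb : BddAbove (Set.range fun θ => opVal A H θ x fun y => φ y τ)
    · obtain ⟨θ⟩ := ‹Nonempty Θ›
      exact (hop θ).trans (le_ciSup hb θ)
    · rw [Real.iSup_of_not_bddAbove hb]
      have : 0 < B / M := by positivity
      linarith
  linarith

end LargeTimeBehavior
end
end

section
/- Let f: 𝕋^N → ℝ be nonnegative, F: 𝕋^N×ℝ^N → ℝ strictly positive, h: 𝕋^N → ℝ^N, and define ψ(x,p) := |p+h(x)|² − |h(x)|² and H(x,p) := ψ(x,p)F(x,p/|p|) − f(x) for p ≠ 0, H(x,0) := −f(x). Then for every μ > 1, x ∈ 𝕋^N and p ≠ 0: H(x,μp) − μH(x,p) = (μ²−μ)|p|² F(x,p/|p|) + (μ−1)f(x) > 0; and for p = 0: H(x,0) − μH(x,0) = (μ−1)f(x) ≥ 0. In particular H satisfies condition (H10) with c = 0 and K = ∅. -/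
open Filter
open scoped RealInnerProductSpace Matrix

noncomputable section

namespace LargeTimeBehavior

variable {N : ℕ} {Θ : Type*}

theorem statement14
    {N : ℕ}
    (f : E N → ℝ) (hf : ∀ x : E N, 0 ≤ f x) (hfper : ZPeriodic f)
    (F : E N → E N → ℝ) (hF : ∀ (x p : E N), 0 < F x p) (hFper : ∀ p : E N, ZPeriodic fun x => F x p)
    (h : E N → E N) (hhper : ZPeriodic h) :
    (∀ μ : ℝ, 1 < μ → ∀ (x p : E N), p ≠ 0 →
      ((‖μ • p + h x‖^2 - ‖h x‖^2) * F x (‖μ • p‖⁻¹ • (μ • p)) - f x)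
          - μ * ((‖p + h x‖^2 - ‖h x‖^2) * F x (‖p‖⁻¹ • p) - f x)
        = (μ^2 - μ) * ‖p‖^2 * F x (‖p‖⁻¹ • p) + (μ - 1) * f x ∧
      0 < ((‖μ • p + h x‖^2 - ‖h x‖^2) * F x (‖μ • p‖⁻¹ • (μ • p)) - f x)
          - μ * ((‖p + h x‖^2 - ‖h x‖^2) * F x (‖p‖⁻¹ • p) - f x)) ∧
    (∀ μ : ℝ, 1 < μ → ∀ x : E N,
      ((‖(0:E N) + h x‖^2 - ‖h x‖^2) * F x (‖(0:E N)‖⁻¹ • (0:E N)) - f x)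
          - μ * ((‖(0:E N) + h x‖^2 - ‖h x‖^2) * F x (‖(0:E N)‖⁻¹ • (0:E N)) - f x)
        = (μ - 1) * f x ∧
      0 ≤ ((‖(0:E N) + h x‖^2 - ‖h x‖^2) * F x (‖(0:E N)‖⁻¹ • (0:E N)) - f x)
          - μ * ((‖(0:E N) + h x‖^2 - ‖h x‖^2) * F x (‖(0:E N)‖⁻¹ • (0:E N)) - f x)) := by
  have key : ∀ μ : ℝ, 1 < μ → ∀ (x p : E N), p ≠ 0 →
      ((‖μ • p + h x‖^2 - ‖h x‖^2) * F x (‖μ • p‖⁻¹ • (μ • p)) - f x)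
          - μ * ((‖p + h x‖^2 - ‖h x‖^2) * F x (‖p‖⁻¹ • p) - f x)
        = (μ^2 - μ) * ‖p‖^2 * F x (‖p‖⁻¹ • p) + (μ - 1) * f x := by
    intro μ hμ x p hp
    have hμ0 : 0 < μ := by linarith
    have hn : ‖μ • p‖ = μ * ‖p‖ := by rw [norm_smul, Real.norm_of_nonneg hμ0.le]
    have hd : ‖μ • p‖⁻¹ • (μ • p) = ‖p‖⁻¹ • p := by
      rw [hn, smul_smul]
      congr 1
      have : ‖p‖ ≠ 0 := norm_ne_zero_iff.mpr hp
      field_simp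
    rw [hd, norm_add_sq_real, norm_add_sq_real, hn, real_inner_smul_left]
    ring
  refine ⟨fun μ hμ x p hp => ⟨key μ hμ x p hp, ?_⟩, fun μ hμ x => ?_⟩
  · rw [key μ hμ x p hp]
    have h1 : 0 < (μ^2 - μ) := by nlinarith
    have h2 : 0 < ‖p‖ := norm_pos_iff.mpr hp
    have h3 := hF x (‖p‖⁻¹ • p)
    have h4 : 0 ≤ (μ - 1) * f x := mul_nonneg (by linarith) (hf x)
    have h5 : 0 < (μ^2 - μ) * ‖p‖^2 * F x (‖p‖⁻¹ • p) :=
      mul_pos (mul_pos h1 (pow_pos h2 2)) h3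
    linarith
  · have h4 : 0 ≤ (μ - 1) * f x := mul_nonneg (by linarith) (hf x)
    rw [zero_add, sub_self, zero_mul]
    constructor
    · ring
    · linarith

end LargeTimeBehavior
end
end

section
/- Let H_θ(x,p) := F_θ(x,p) − f_θ(x), where for every θ∈Θ: f_θ: 𝕋^N → ℝ is Lipschitz, F_θ: 𝕋^N×ℝ^N → ℝ is convex in p with F_θ(x,p) ≥ F_θ(x,0) = 0 for all (x,p); assume the infimum m := inf_{y∈𝕋^N, θ∈Θ} f_θ(y) is attained and the set K := {x ∈ Σ : f_θ(x) = m for all θ∈Θ} is nonempty, and that inf_{θ∈Θ} f_θ(x) > m for every x ∈ Σ\K. Set c := −m. Then (H10) holds: (i) H_θ(x,μp) − μH_θ(x,p) ≥ (1−μ)c for all (x,p) ∈ 𝕋^N×ℝ^N, θ∈Θ and μ>1; (ii)(a) H_θ(x,p) ≥ c for all (x,p) ∈ K×ℝ^N and θ∈Θ; and (ii)(b) inf_{θ∈Θ}{H_θ(x,μp) − μH_θ(x,p)} > (1−μ)c for every x ∈ Σ with dist(x,K) ≠ 0, every p ∈ ℝ^N and every μ > 1. -/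
open Filter
open scoped RealInnerProductSpace Matrix

noncomputable section

namespace LargeTimeBehavior

variable {N : ℕ} {Θ : Type*}

theorem statement17
    {N : ℕ} {Θ : Type*} [MetricSpace Θ] [Nonempty Θ]
    (Sig : Set (E N)) (hSig : IsClosed Sig)
    (f : Θ → E N → ℝ) (hflip : ∀ θ : Θ, ∃ L : NNReal, LipschitzWith L (f θ))
    (F : Θ → E N → E N → ℝ)
    (hFconv : ∀ (θ : Θ) (x : E N), ConvexOn ℝ Set.univ (F θ x))
    (hF0 : ∀ (θ : Θ) (x : E N), F θ x 0 = 0)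
    (hFpos : ∀ (θ : Θ) (x p : E N), 0 ≤ F θ x p)
    -- m = inf_{y,θ} f_θ(y), attained
    (m : ℝ) (hmle : ∀ (θ : Θ) (y : E N), m ≤ f θ y) (hmatt : ∃ (θ : Θ) (y : E N), f θ y = m)
    -- K = {x ∈ Σ : f_θ(x) = m for all θ} is nonempty
    (hKne : {x ∈ Sig | ∀ θ : Θ, f θ x = m}.Nonempty)
    -- inf_θ f_θ(x) > m for x ∈ Σ \ K
    (hstrict : ∀ x ∈ Sig, x ∉ {x ∈ Sig | ∀ θ : Θ, f θ x = m} → m < ⨅ θ, f θ x) :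
    -- (H10) holds with c = −m and K as above, for H_θ(x,p) = F_θ(x,p) − f_θ(x)
    (∀ (θ : Θ) (x p : E N) (μ : ℝ), 1 < μ →
      (1 - μ) * (-m) ≤ (F θ x (μ • p) - f θ x) - μ * (F θ x p - f θ x)) ∧
    (∀ θ : Θ, ∀ x ∈ {x ∈ Sig | ∀ θ : Θ, f θ x = m}, ∀ p : E N,
      -m ≤ F θ x p - f θ x) ∧
    (∀ x ∈ Sig, x ∉ {x ∈ Sig | ∀ θ : Θ, f θ x = m} → ∀ (p : E N) (μ : ℝ), 1 < μ →
      (1 - μ) * (-m) < ⨅ θ, ((F θ x (μ • p) - f θ x) - μ * (F θ x p - f θ x))) := by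
  have key : ∀ (θ : Θ) (x p : E N) (μ : ℝ), 1 < μ → μ * F θ x p ≤ F θ x (μ • p) := by
    intro θ x p μ hμ
    have hμ0 : 0 < μ := by linarith
    have h1 : μ⁻¹ ≤ 1 := inv_le_one_of_one_le₀ hμ.le
    have h := (hFconv θ x).2 (Set.mem_univ (μ • p)) (Set.mem_univ (0 : E N))
      (inv_nonneg.2 hμ0.le) (sub_nonneg.2 h1) (by ring)
    rw [smul_zero, add_zero, smul_smul, inv_mul_cancel₀ hμ0.ne', one_smul, hF0] at h
    simp only [smul_eq_mul, mul_zero, add_zero] at h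
    calc μ * F θ x p ≤ μ * (μ⁻¹ * F θ x (μ • p)) := mul_le_mul_of_nonneg_left h hμ0.le
      _ = F θ x (μ • p) := by rw [← mul_assoc, mul_inv_cancel₀ hμ0.ne', one_mul]
  refine ⟨?_, ?_, ?_⟩
  · intro θ x p μ hμ
    have h1 := key θ x p μ hμ
    have h2 := mul_le_mul_of_nonneg_left (hmle θ x) (sub_nonneg.2 hμ.le)
    linarith
  · intro θ x hx p
    have h1 := hx.2 θ
    have h2 := hFpos θ x p
    linarith
  · intro x hx hxK p μ hμ
    have hs := hstrict x hx hxK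
    have hb : BddBelow (Set.range fun θ => f θ x) := ⟨m, by rintro _ ⟨θ, rfl⟩; exact hmle θ x⟩
    refine lt_of_lt_of_le (b := (μ - 1) * ⨅ θ, f θ x) ?_ (le_ciInf fun θ => ?_)
    · have := mul_lt_mul_of_pos_left hs (sub_pos.2 hμ)
      linarith
    · have h1 := key θ x p μ hμ
      have h2 := mul_le_mul_of_nonneg_left (ciInf_le hb θ) (sub_nonneg.2 hμ.le)
      linarith

end LargeTimeBehavior
end
end

section
/- Let σ: ℝ^N → M_N(ℝ) satisfy trace(σ(x)σ(x)^T) ≤ C² for all x, where C > 0, and let r > 0 and ν > 0. Define ψ(x) := e^{−γr²} − e^{−γ|x|²} for γ > 0. Then Dψ(x) = 2γ x e^{−γ|x|²} and D²ψ(x) = e^{−γ|x|²}(2γ I − 4γ² x⊗x), and for every x with |x| ≤ r and |σ(x)^T x|² ≥ ν (equivalently ⟨σ(x)σ(x)^T x, x⟩ ≥ ν) and every γ with 2γν > C² + Cr, one has −trace(σ(x)σ(x)^T D²ψ(x)) − C|Dψ(x)| ≥ 2γ e^{−γ|x|²}(2γν − C² − Cr) > 0. -/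
open Filter
open scoped RealInnerProductSpace Matrix

noncomputable section

namespace LargeTimeBehavior

variable {N : ℕ} {Θ : Type*}

theorem psi_hasFDerivAt {N : ℕ} (r γ : ℝ) (x : E N) :
    HasFDerivAt (fun y : E N => Real.exp (-γ * r^2) - Real.exp (-γ * ‖y‖^2))
      ((2 * γ * Real.exp (-γ * ‖x‖^2)) • innerSL ℝ x) x := by
  have h1 : HasFDerivAt (fun y : E N => ‖y‖^2) (2 • innerSL ℝ x) x :=
    (hasStrictFDerivAt_norm_sq x).hasFDerivAt
  have h2 := ((h1.const_mul (-γ)).exp).const_sub (Real.exp (-γ * r^2))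
  refine h2.congr_fderiv ?_
  ext v
  simp
  ring

theorem psi_gradient {N : ℕ} (r γ : ℝ) (x : E N) :
    gradient (fun y : E N => Real.exp (-γ * r^2) - Real.exp (-γ * ‖y‖^2)) x
        = (2 * γ * Real.exp (-γ * ‖x‖^2)) • x := by
  apply HasGradientAt.gradient
  rw [hasGradientAt_iff_hasFDerivAt]
  refine (psi_hasFDerivAt r γ x).congr_fderiv ?_
  ext v
  simp [inner_smul_left]

theorem psi_hess {N : ℕ} (r γ : ℝ) (x : E N) :
    hessMatrix (fun y : E N => Real.exp (-γ * r^2) - Real.exp (-γ * ‖y‖^2)) x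
        = Real.exp (-γ * ‖x‖^2) • ((2 * γ) • (1 : Matrix (Fin N) (Fin N) ℝ)
            - (4 * γ^2) • Matrix.of fun i j => x i * x j) := by
  ext i j
  have e : (fun y : E N => fderiv ℝ (fun y : E N => Real.exp (-γ * r^2)
      - Real.exp (-γ * ‖y‖^2)) y (EuclideanSpace.single j 1))
      = fun y : E N => (2 * γ * Real.exp (-γ * ‖y‖^2)) * y j := by
    funext y
    rw [(psi_hasFDerivAt r γ y).fderiv]
    simp [EuclideanSpace.inner_single_right]
  have h1 : HasFDerivAt (fun y : E N => ‖y‖^2) (2 • innerSL ℝ x) x :=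
    (hasStrictFDerivAt_norm_sq x).hasFDerivAt
  have h2 := ((h1.const_mul (-γ)).exp).const_mul (2 * γ)
  have h3 : HasFDerivAt (fun y : E N => y j) (EuclideanSpace.proj j : E N →L[ℝ] ℝ) x :=
    (EuclideanSpace.proj j : E N →L[ℝ] ℝ).hasFDerivAt
  have h4 := h2.mul h3
  have h5 := h4.fderiv
  simp only [hessMatrix, Matrix.of_apply]
  rw [e]
  erw [h5]
  by_cases hij : i = j
  · subst hij
    simp [EuclideanSpace.inner_single_right]
    ring
  · have hji : j ≠ i := fun h => hij h.symm
    simp [EuclideanSpace.inner_single_right, Matrix.one_apply, hij, hji]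
    ring

theorem trace_outer {N : ℕ} (S : Matrix (Fin N) (Fin N) ℝ) (v : Fin N → ℝ) :
    Matrix.trace (S * Sᵀ * Matrix.of fun i j => v i * v j)
      = ∑ i, (Sᵀ.mulVec v i)^2 := by
  have h : (Matrix.of fun i j => v i * v j) = Matrix.vecMulVec v v := rfl
  rw [h, Matrix.mul_vecMulVec, Matrix.trace_vecMulVec, ← Matrix.mulVec_mulVec, dotProduct_comm,
    Matrix.dotProduct_mulVec, ← Matrix.mulVec_transpose]
  simp [dotProduct, sq]

theorem statement19
    {N : ℕ}
    (σ : E N → Matrix (Fin N) (Fin N) ℝ)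
    (C r ν γ : ℝ) (hC : 0 < C) (hr : 0 < r) (hν : 0 < ν) (hγ : 0 < γ)
    (htr : ∀ x : E N, Matrix.trace (σ x * (σ x)ᵀ) ≤ C^2) :
    (∀ x : E N,
      gradient (fun y : E N => Real.exp (-γ * r^2) - Real.exp (-γ * ‖y‖^2)) x
        = (2 * γ * Real.exp (-γ * ‖x‖^2)) • x) ∧
    (∀ x : E N,
      hessMatrix (fun y : E N => Real.exp (-γ * r^2) - Real.exp (-γ * ‖y‖^2)) x
        = Real.exp (-γ * ‖x‖^2) • ((2 * γ) • (1 : Matrix (Fin N) (Fin N) ℝ)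
            - (4 * γ^2) • Matrix.of fun i j => x i * x j)) ∧
    (∀ x : E N, ‖x‖ ≤ r → ν ≤ ∑ i, ((σ x)ᵀ.mulVec (fun j => x j) i)^2 →
      C^2 + C * r < 2 * γ * ν →
      2 * γ * Real.exp (-γ * ‖x‖^2) * (2 * γ * ν - C^2 - C * r)
          ≤ -Matrix.trace (σ x * (σ x)ᵀ
              * hessMatrix (fun y : E N => Real.exp (-γ * r^2) - Real.exp (-γ * ‖y‖^2)) x)
            - C * ‖gradient (fun y : E N => Real.exp (-γ * r^2) - Real.exp (-γ * ‖y‖^2)) x‖ ∧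
      0 < 2 * γ * Real.exp (-γ * ‖x‖^2) * (2 * γ * ν - C^2 - C * r)) := by
  refine ⟨psi_gradient r γ, psi_hess r γ, fun x hx hs hlt => ?_⟩
  have he := Real.exp_pos (-γ * ‖x‖^2)
  refine ⟨?_, by
    have : 0 < 2 * γ * ν - C^2 - C * r := by linarith
    positivity⟩
  rw [psi_gradient, psi_hess, norm_smul, Real.norm_of_nonneg (by positivity)]
  rw [Matrix.mul_smul, Matrix.mul_sub, Matrix.mul_smul, Matrix.mul_smul, Matrix.trace_smul,
    Matrix.trace_sub, Matrix.trace_smul, Matrix.trace_smul, trace_outer, mul_one]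
  simp only [smul_eq_mul]
  have ht := htr x
  set e := Real.exp (-γ * ‖x‖^2)
  set T := Matrix.trace (σ x * (σ x)ᵀ)
  set S := ∑ i, ((σ x)ᵀ.mulVec (fun j => x j) i)^2
  have a1 : 0 ≤ (2 * γ * e) * (C^2 - T) := mul_nonneg (by positivity) (by linarith)
  have a2 : 0 ≤ (4 * γ^2 * e) * (S - ν) := mul_nonneg (by positivity) (by linarith)
  have a3 : 0 ≤ (2 * γ * e * C) * (r - ‖x‖) := mul_nonneg (by positivity) (by linarith)
  linarith


end LargeTimeBehavior
end
end
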